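/- On the board Rhombus(6), there is no hole v and no solution to the single-vacancy peg solitaire problem with vacancy v whose last move is a sweep of length 16 beginning at b1 = (1,0) and ending at f5 = (5,4). -/

import Mathlib

/-- The six jump directions on the triangular lattice (oblique coordinates). -/
def Dirs : Finset (ℤ × ℤ) := {(1,0), (-1,0), (0,1), (0,-1), (1,1), (-1,-1)}

/-- The rhombus board of side `n`: `{0,…,n−1} × {0,…,n−1}`. -/
noncomputable def Rhombus (n : ℕ) : Finset (ℤ × ℤ) :=
  Finset.Icc (0 : ℤ) ((n : ℤ) - 1) ×ˢ Finset.Icc (0 : ℤ) ((n : ℤ) - 1)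

/-- A jump in position `P` on board `B`: peg at `p`, direction `d ∈ Dirs`,
peg at `p+d`, empty board hole at `p+2d`. -/
def JumpOK (B P : Finset (ℤ × ℤ)) (p d : ℤ × ℤ) : Prop :=
  d ∈ Dirs ∧ p ∈ P ∧ p + d ∈ P ∧ p + d + d ∈ B ∧ p + d + d ∉ P

/-- The position resulting from the jump `(p, d)` in position `P`. -/
def jumpResult (P : Finset (ℤ × ℤ)) (p d : ℤ × ℤ) : Finset (ℤ × ℤ) :=
  (P \ {p, p + d}) ∪ {p + d + d}

/-- `SweepFrom B P s ds e Q`: starting in position `P`, the peg at `s` makes the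
consecutive jumps with directions `ds` (each jump starting where the previous landed),
ending at hole `e` and producing position `Q`.  A move is such a sweep with `ds ≠ []`;
its length (number of pegs captured) is `ds.length`. -/
inductive SweepFrom (B : Finset (ℤ × ℤ)) :
    Finset (ℤ × ℤ) → ℤ × ℤ → List (ℤ × ℤ) → ℤ × ℤ → Finset (ℤ × ℤ) → Prop
  | nil (P : Finset (ℤ × ℤ)) (s : ℤ × ℤ) : SweepFrom B P s [] s P
  | cons {P : Finset (ℤ × ℤ)} {s d e : ℤ × ℤ} {ds : List (ℤ × ℤ)} {Q : Finset (ℤ × ℤ)} :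
      JumpOK B P s d → SweepFrom B (jumpResult P s d) (s + d + d) ds e Q →
      SweepFrom B P s (d :: ds) e Q

/-- A move is recorded as a pair (starting hole, nonempty list of jump directions).
`PlayMove B P m Q` says the move `m` is legal in position `P` and produces `Q`. -/
def PlayMove (B P : Finset (ℤ × ℤ)) (m : (ℤ × ℤ) × List (ℤ × ℤ))
    (Q : Finset (ℤ × ℤ)) : Prop :=
  m.2 ≠ [] ∧ ∃ e, SweepFrom B P m.1 m.2 e Q

/-- `Plays B P ms Q`: the finite sequence of moves `ms` leads from position `P`
to position `Q` on board `B`. -/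
inductive Plays (B : Finset (ℤ × ℤ)) :
    Finset (ℤ × ℤ) → List ((ℤ × ℤ) × List (ℤ × ℤ)) → Finset (ℤ × ℤ) → Prop
  | nil (P : Finset (ℤ × ℤ)) : Plays B P [] P
  | cons {P Q R : Finset (ℤ × ℤ)} {m : (ℤ × ℤ) × List (ℤ × ℤ)}
      {ms : List ((ℤ × ℤ) × List (ℤ × ℤ))} :
      PlayMove B P m Q → Plays B Q ms R → Plays B P (m :: ms) R

/-- The list of all holes touched by a sweep starting at `s` with directions `ds`:
every starting hole, every jumped-over hole and every landing hole. -/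
def sweepHoles (s : ℤ × ℤ) : List (ℤ × ℤ) → List (ℤ × ℤ)
  | [] => [s]
  | d :: ds => s :: (s + d) :: sweepHoles (s + d + d) ds

/-- The hole where a sweep starting at `s` with directions `ds` ends. -/
def sweepEnd (s : ℤ × ℤ) : List (ℤ × ℤ) → ℤ × ℤ
  | [] => s
  | d :: ds => sweepEnd (s + d + d) ds

/-- A single jump as a step relation between positions on board `B`. -/
def JumpStep (B P Q : Finset (ℤ × ℤ)) : Prop :=
  ∃ p d, JumpOK B P p d ∧ Q = jumpResult P p d

namespace RhombusSearch

/-! ### Layers of positions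

A set of holes, given by its indicator function on hole numbers, is coded by the pair of its `key`
(a binary number read off from the key holes) and its `leaf` (read off from the leaf holes).
A `Layer` is a list of entries `(K, X)`, standing for the codes `(K, i)` with `X.testBit i`.
The functions below are evaluated by the kernel, hence the recursors in place of pattern matching
and the named operations on `ℕ`. -/

/-- A list of keys, each with a bit set of leaves. -/
inductive Layer
  | nil
  | cons (K X : ℕ) (rest : Layer)

/-- A layer cut into pieces. -/
inductive Chunks
  | nil
  | cons (head : Layer) (rest : Chunks)

/-- The code `(k, i)` belongs to the layer. -/
def Layer.Has (k i : ℕ) : Layer → Prop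
  | .nil => False
  | .cons K X r => (K = k ∧ X.testBit i) ∨ r.Has k i

/-- The code `(k, i)` belongs to one of the pieces. -/
def Chunks.Has (k i : ℕ) : Chunks → Prop
  | .nil => False
  | .cons L C => L.Has k i ∨ C.Has k i

noncomputable def Layer.isNil (L : Layer) : Bool :=
  Layer.rec true (fun _ _ _ _ => false) L

noncomputable def Layer.take (n : ℕ) : Layer → Layer :=
  Nat.rec (fun _ => .nil) (fun _ ih L =>
    Layer.rec (motive := fun _ => (Layer → Layer) → Layer) (fun _ => .nil)
      (fun K X r _ ih => .cons K X (ih r)) L ih) n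

noncomputable def Layer.drop (n : ℕ) : Layer → Layer :=
  Nat.rec (fun L => L) (fun _ ih L =>
    Layer.rec (motive := fun _ => (Layer → Layer) → Layer) (fun _ => .nil)
      (fun _ _ r _ ih => ih r) L ih) n

/-- Drops `2 ^ d` entries, with recursion depth of order `d ^ 2` only. -/
noncomputable def Layer.dropPow (d : ℕ) : Layer → Layer :=
  Nat.rec (fun L => Layer.rec .nil (fun _ _ r _ => r) L) (fun _ ih L =>
    Layer.rec (motive := fun _ => (Layer → Layer) → Layer) (fun _ => .nil)
      (fun K X r _ ih => ih (ih (.cons K X r))) L ih) d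

noncomputable def Layer.append (L M : Layer) : Layer :=
  Layer.rec M (fun K X _ ih => .cons K X ih) L

/-- Cuts a layer into `n` pieces of length at most `64` and a rest. -/
noncomputable def Layer.chop (n : ℕ) : Layer → Chunks :=
  Nat.rec (fun L => .cons L .nil) (fun _ ih L =>
    Layer.rec (motive := fun _ => (Layer → Chunks) → Chunks) (fun _ => .nil)
      (fun K X r _ ih => .cons (Layer.take 64 (.cons K X r)) (ih (Layer.drop 64 (.cons K X r))))
      L ih) n

/-- The union of two layers, in increasing order of the keys if both layers are. -/
noncomputable def Layer.merge (L : Layer) : Layer → Layer :=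
  Layer.rec (fun M => M) (fun K X r ih M => Layer.rec (.cons K X r) (fun K' X' r' ih' =>
    Bool.rec (.cons K' X' ih')
      (Bool.rec (.cons K X (ih (.cons K' X' r'))) (.cons K (Nat.lor X X') (ih r'))
        (Nat.beq K K'))
      (Nat.ble K K')) M) L

/-- One jump: from the keys that agree with `eh` on the mask `mh` and the leaves in the bit set
`pt`, flip the mask in the key, subtract `dn` from the leaf and add `up` to it. -/
noncomputable def Layer.jump (mh eh pt dn up : ℕ) (L : Layer) : Layer :=
  Layer.rec .nil (fun K X _ ih =>
    Bool.rec (motive := fun _ => ℕ → ℕ → Layer → Layer) (fun _ _ ih => ih)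
      (fun K X ih => Bool.rec
        (.cons (Nat.xor K mh) (Nat.shiftLeft (Nat.shiftRight (Nat.land X pt) dn) up) ih) ih
        (Nat.beq (Nat.land X pt) 0))
      (Nat.beq (Nat.land K mh) eh) K X ih) L

noncomputable def Chunks.jump (mh eh pt dn up : ℕ) (C : Chunks) : Layer :=
  Chunks.rec .nil (fun L _ ih => Layer.append (Layer.jump mh eh pt dn up L) ih) C

/-- A binary tree of jumps, given by the parameters of `Layer.jump`. -/
inductive JumpTree
  | jump (mh eh pt dn up : ℕ)
  | both (s t : JumpTree)

/-- The codes obtained by making one of the jumps of the tree. -/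
noncomputable def JumpTree.image (t : JumpTree) : Chunks → Layer :=
  JumpTree.rec Chunks.jump (fun _ _ f g C => Layer.merge (f C) (g C)) t

namespace Layer

variable {k i : ℕ}

theorem has_take_or_drop (n : ℕ) (L : Layer) (h : L.Has k i) :
    (take n L).Has k i ∨ (drop n L).Has k i := by
  induction n generalizing L with
  | zero => exact .inr h
  | succ n ih =>
    cases L with
    | nil => exact h.elim
    | cons K X r =>
      rcases h with h | h
      · exact .inl (.inl h)
      · exact (ih r h).imp .inr id

theorem has_chop (n : ℕ) (L : Layer) (h : L.Has k i) : (chop n L).Has k i := by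
  induction n generalizing L with
  | zero => exact .inl h
  | succ n ih =>
    cases L with
    | nil => exact h.elim
    | cons K X r => exact (has_take_or_drop 64 _ h).imp id (ih _)

theorem has_append {L M : Layer} (h : L.Has k i ∨ M.Has k i) : (append L M).Has k i := by
  induction L with
  | nil => exact h.resolve_left id
  | cons K X r ih =>
    rcases h with (h | h) | h
    · exact .inl h
    · exact .inr (ih (.inl h))
    · exact .inr (ih (.inr h))

theorem beq_eq_false_of_ne {a b : ℕ} (h : a ≠ b) : Nat.beq a b = false :=
  Bool.eq_false_iff.2 fun e => h (Nat.eq_of_beq_eq_true e)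

theorem merge_cons_cons (K X K' X' : ℕ) (r r' : Layer) :
    merge (.cons K X r) (.cons K' X' r') =
      if K ≤ K' then
        if K = K' then .cons K (X ||| X') (merge r r') else .cons K X (merge r (.cons K' X' r'))
      else .cons K' X' (merge (.cons K X r) r') := by
  have h : merge (.cons K X r) (.cons K' X' r') =
      Bool.rec (.cons K' X' (merge (.cons K X r) r'))
        (Bool.rec (.cons K X (merge r (.cons K' X' r'))) (.cons K (X ||| X') (merge r r'))
          (Nat.beq K K')) (Nat.ble K K') := rfl
  rw [h]
  split_ifs with h₁ h₂
  · rw [Nat.ble_eq_true_of_le h₁, h₂, Nat.beq_refl]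
  · rw [Nat.ble_eq_true_of_le h₁, beq_eq_false_of_ne h₂]
  · rw [Bool.eq_false_iff.2 fun e => h₁ (Nat.le_of_ble_eq_true e)]

theorem has_merge {L M : Layer} (h : L.Has k i ∨ M.Has k i) : (merge L M).Has k i := by
  induction L generalizing M with
  | nil => exact h.resolve_left id
  | cons K X r ih =>
    induction M with
    | nil => exact h.resolve_right id
    | cons K' X' r' ih' =>
      rw [merge_cons_cons]
      split_ifs with h₁ h₂
      · subst h₂
        rcases h with (h | h) | (h | h)
        · exact .inl ⟨h.1, by simp [h.2]⟩
        · exact .inr (ih (.inl h))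
        · exact .inl ⟨h.1, by simp [h.2]⟩
        · exact .inr (ih (.inr h))
      · rcases h with (h | h) | h
        · exact .inl h
        · exact .inr (ih (.inl h))
        · exact .inr (ih (.inr h))
      · rcases h with h | (h | h)
        · exact .inr (ih' (.inl h))
        · exact .inl h
        · exact .inr (ih' (.inr h))

theorem jump_cons (mh eh pt dn up K X : ℕ) (r : Layer) :
    jump mh eh pt dn up (.cons K X r) =
      if K &&& mh = eh ∧ X &&& pt ≠ 0 then
        .cons (K ^^^ mh) ((X &&& pt) >>> dn <<< up) (jump mh eh pt dn up r)
      else jump mh eh pt dn up r := by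
  have h : jump mh eh pt dn up (.cons K X r) =
      Bool.rec (motive := fun _ => ℕ → ℕ → Layer → Layer) (fun _ _ ih => ih)
        (fun K X ih => Bool.rec (.cons (K ^^^ mh) ((X &&& pt) >>> dn <<< up) ih) ih
          (Nat.beq (X &&& pt) 0))
        (Nat.beq (K &&& mh) eh) K X (jump mh eh pt dn up r) := rfl
  rw [h]
  by_cases h₁ : K &&& mh = eh
  · by_cases h₂ : X &&& pt = 0
    · simp [h₁, h₂]
    · rw [if_pos ⟨h₁, h₂⟩, h₁, Nat.beq_refl]
      simp only [beq_eq_false_of_ne h₂]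
  · rw [if_neg (fun h => h₁ h.1), beq_eq_false_of_ne h₁]

theorem has_jump {mh eh pt dn up j : ℕ} {L : Layer} (h : L.Has k i) (hk : k &&& mh = eh)
    (hi : pt.testBit i) (hup : up ≤ j) (hij : i + up = j + dn) :
    (jump mh eh pt dn up L).Has (k ^^^ mh) j := by
  induction L with
  | nil => exact h.elim
  | cons K X r ih =>
    rw [jump_cons]
    rcases h with ⟨rfl, hX⟩ | h
    · have hY : (X &&& pt).testBit i := by simp [hX, hi]
      rw [if_pos ⟨hk, fun h₀ => by simp [h₀] at hY⟩]
      refine .inl ⟨rfl, ?_⟩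
      rw [Nat.testBit_shiftLeft, Nat.testBit_shiftRight, show dn + (j - up) = i by omega, hY]
      simpa using hup
    · split_ifs
      · exact .inr (ih h)
      · exact ih h

end Layer

theorem Chunks.has_jump {k i mh eh pt dn up j : ℕ} {C : Chunks} (h : C.Has k i)
    (hk : k &&& mh = eh) (hi : pt.testBit i) (hup : up ≤ j) (hij : i + up = j + dn) :
    (jump mh eh pt dn up C).Has (k ^^^ mh) j := by
  induction C with
  | nil => exact h.elim
  | cons L C ih =>
    exact Layer.has_append (h.imp (fun h => Layer.has_jump h hk hi hup hij) ih)

namespace JumpTree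

/-- Every code obtained by a jump of `s` is obtained by a jump of `t`. -/
def Sub (s t : JumpTree) : Prop :=
  ∀ ⦃C k i⦄, (s.image C).Has k i → (t.image C).Has k i

theorem Sub.rfl {t : JumpTree} : Sub t t := fun _ _ _ h => h

theorem Sub.left {r s : JumpTree} (t : JumpTree) (h : Sub r s) : Sub r (both s t) :=
  fun _ _ _ h' => Layer.has_merge (.inl (h h'))

theorem Sub.right {r t : JumpTree} (s : JumpTree) (h : Sub r t) : Sub r (both s t) :=
  fun _ _ _ h' => Layer.has_merge (.inr (h h'))

/-- The jumps of `f 0, …, f n`. -/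
noncomputable def union (n : ℕ) (f : ℕ → JumpTree) : JumpTree :=
  Nat.rec (f 0) (fun k t => .both t (f (Nat.add k 1))) n

theorem Sub.union {t : JumpTree} {f : ℕ → JumpTree} {n j : ℕ} (hj : j ≤ n) (h : Sub t (f j)) :
    Sub t (union n f) := by
  induction n with
  | zero => rwa [Nat.le_zero.1 hj] at h
  | succ n ih =>
    rcases Nat.le_succ_iff.1 hj with hj | rfl
    · exact (ih hj).left _
    · exact h.right _

end JumpTree

/-! ### Coding sets of holes -/

/-- The binary number with digits `c h`, least significant digit first. -/
noncomputable def key (c : ℕ → Bool) (l : List ℕ) : ℕ :=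
  List.rec 0 (fun h _ ih => Bool.rec (Nat.mul 2 ih) (Nat.add (Nat.mul 2 ih) 1) (c h)) l

/-- The binary number with digits `c h`, most significant digit first. -/
noncomputable def leaf (c : ℕ → Bool) (l : List ℕ) : ℕ :=
  List.rec 0 (fun h t ih => Bool.rec ih (Nat.add (Nat.pow 2 t.length) ih) (c h)) l

/-- The set of leaves of the sets of holes that contain `e` and are disjoint from `f`. -/
noncomputable def pattern (e f : ℕ → Bool) (l : List ℕ) : ℕ :=
  List.rec 1 (fun h t p => Bool.rec
    (Bool.rec (Nat.lor p (Nat.shiftLeft p (Nat.pow 2 t.length))) p (f h))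
    (Nat.shiftLeft p (Nat.pow 2 t.length)) (e h)) l

theorem key_cons (c : ℕ → Bool) (h : ℕ) (l : List ℕ) :
    key c (h :: l) = Nat.bit (c h) (key c l) := by
  have : key c (h :: l) = Bool.rec (2 * key c l) (2 * key c l + 1) (c h) := rfl
  rw [this]
  cases c h <;> rfl

theorem leaf_cons (c : ℕ → Bool) (h : ℕ) (l : List ℕ) :
    leaf c (h :: l) = (c h).toNat * 2 ^ l.length + leaf c l := by
  have : leaf c (h :: l) = Bool.rec (leaf c l) (2 ^ l.length + leaf c l) (c h) := rfl
  rw [this]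
  cases c h <;> simp

theorem pattern_cons (e f : ℕ → Bool) (h : ℕ) (l : List ℕ) :
    pattern e f (h :: l) =
      if e h then pattern e f l <<< 2 ^ l.length
      else if f h then pattern e f l
      else pattern e f l ||| pattern e f l <<< 2 ^ l.length := by
  have : pattern e f (h :: l) = Bool.rec
    (Bool.rec (pattern e f l ||| pattern e f l <<< 2 ^ l.length) (pattern e f l) (f h))
    (pattern e f l <<< 2 ^ l.length) (e h) := rfl
  rw [this]
  cases e h <;> cases f h <;> rfl

theorem key_congr {u v : ℕ → Bool} {l : List ℕ} (h : ∀ x ∈ l, u x = v x) :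
    key u l = key v l := by
  induction l with
  | nil => rfl
  | cons x l ih =>
    rw [List.forall_mem_cons] at h
    rw [key_cons, key_cons, h.1, ih h.2]

theorem leaf_congr {u v : ℕ → Bool} {l : List ℕ} (h : ∀ x ∈ l, u x = v x) :
    leaf u l = leaf v l := by
  induction l with
  | nil => rfl
  | cons x l ih =>
    rw [List.forall_mem_cons] at h
    rw [leaf_cons, leaf_cons, h.1, ih h.2]

theorem key_land (u v : ℕ → Bool) (l : List ℕ) :
    key u l &&& key v l = key (fun x => u x && v x) l := by
  induction l with
  | nil => exact Nat.and_self 0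
  | cons x l ih => rw [key_cons, key_cons, key_cons, Nat.land_bit, ih]

theorem key_xor (u v : ℕ → Bool) (l : List ℕ) :
    key u l ^^^ key v l = key (fun x => u x ^^ v x) l := by
  induction l with
  | nil => exact Nat.xor_self 0
  | cons x l ih => rw [key_cons, key_cons, key_cons, Nat.xor_bit, ih]

theorem leaf_mono {u v : ℕ → Bool} {l : List ℕ} (h : ∀ x ∈ l, u x ≤ v x) :
    leaf u l ≤ leaf v l := by
  induction l with
  | nil => exact le_rfl
  | cons x l ih =>
    rw [List.forall_mem_cons] at h
    rw [leaf_cons, leaf_cons]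
    exact Nat.add_le_add (Nat.mul_le_mul_right _ (Bool.toNat_le_toNat h.1)) (ih h.2)

theorem leaf_add_leaf {u v e f : ℕ → Bool} {l : List ℕ}
    (h : ∀ x ∈ l, (u x).toNat + (f x).toNat = (v x).toNat + (e x).toNat) :
    leaf u l + leaf f l = leaf v l + leaf e l := by
  induction l with
  | nil => rfl
  | cons x l ih =>
    rw [List.forall_mem_cons] at h
    simp only [leaf_cons]
    linear_combination 2 ^ l.length * h.1 + ih h.2

theorem testBit_pattern {u e f : ℕ → Bool} {l : List ℕ}
    (h : ∀ x ∈ l, (e x → u x) ∧ (f x → u x = false)) :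
    (pattern e f l).testBit (leaf u l) := by
  induction l with
  | nil => exact Nat.testBit_one_zero
  | cons x l ih =>
    rw [List.forall_mem_cons] at h
    obtain ⟨⟨h₁, h₂⟩, h₃⟩ := h
    have ih := ih h₃
    rw [pattern_cons, leaf_cons]
    split_ifs with he hf
    · simp [h₁ he, ih]
    · simpa [h₂ hf] using ih
    · cases u x <;> simp [ih]

/-! ### Jumps on the rhombus of side 6

The hole `(x, y)` has the number `6 * x + y`. -/

def keyHoles : List ℕ :=
  [32, 22, 9, 14, 27, 19, 6, 24, 2, 23, 5, 15, 10, 20, 33, 30, 28, 7, 12, 25]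

def leafHoles : List ℕ := [35, 17, 4, 1, 13, 26, 31, 34, 18, 21, 16, 8, 3, 29, 11, 0]

/-- The jump that takes pegs from `a` and `b` and puts a peg into `c`. -/
noncomputable def jump (a b c : ℕ) : JumpTree :=
  .jump (key (fun h => or (or (Nat.beq h a) (Nat.beq h b)) (Nat.beq h c)) keyHoles)
    (key (fun h => or (Nat.beq h a) (Nat.beq h b)) keyHoles)
    (pattern (fun h => or (Nat.beq h a) (Nat.beq h b)) (fun h => Nat.beq h c) leafHoles)
    (leaf (fun h => or (Nat.beq h a) (Nat.beq h b)) leafHoles)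
    (leaf (fun h => Nat.beq h c) leafHoles)

/-- The two jumps along the holes `a`, `a + s`, `a + 2 * s`. -/
noncomputable def line (s a : ℕ) : JumpTree :=
  .both (jump a (Nat.add a s) (Nat.add (Nat.add a s) s))
    (jump (Nat.add (Nat.add a s) s) (Nat.add a s) a)

noncomputable def allJumps : JumpTree :=
  .both (JumpTree.union 5 fun x => JumpTree.union 3 fun y => line 1 (6 * x + y))
    (.both (JumpTree.union 3 fun x => JumpTree.union 5 fun y => line 6 (6 * x + y))
      (JumpTree.union 3 fun x => JumpTree.union 3 fun y => line 7 (6 * x + y)))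

/-- The `n`-th iterated image of the layer is empty, so none of its codes admits `n` consecutive
jumps. That the layers on the way have at most `2 ^ 11` entries is checked only to have them
evaluated entry by entry. -/
noncomputable def dies (n : ℕ) : Layer → Bool :=
  Nat.rec Layer.isNil (fun _ ih L =>
    Layer.rec (motive := fun _ => (Layer → Bool) → Bool) (fun _ => true)
      (fun K X r _ ih => Bool.rec false
        (ih (JumpTree.image allJumps (Layer.chop 40 (.cons K X r))))
        (Layer.isNil (Layer.dropPow 11 (.cons K X r)))) L ih) n

/-- `v` arises from `u` by taking pegs from `a` and `b` and putting a peg into `c`. -/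
structure IsJump (a b c : ℕ) (u v : ℕ → Bool) : Prop where
  left : u a = true
  middle : u b = true
  right : u c = false
  result : ∀ h < 36, v h = ((u h && !(Nat.beq h a || Nat.beq h b)) || Nat.beq h c)

/-- The code of `u` belongs to a layer that does not survive `n` jumps. -/
def Doomed (n : ℕ) (u : ℕ → Bool) : Prop :=
  ∃ L : Layer, L.Has (key u keyHoles) (leaf u leafHoles) ∧ dies n L = true

theorem not_doomed_zero (u : ℕ → Bool) : ¬ Doomed 0 u := by
  rintro ⟨_ | ⟨K, X, r⟩, h, hd⟩
  · exact h
  · cases hd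

theorem IsJump.has_image {a b c : ℕ} {u v : ℕ → Bool} (hj : IsJump a b c u v) {C : Chunks}
    (h : C.Has (key u keyHoles) (leaf u leafHoles)) :
    ((jump a b c).image C).Has (key v keyHoles) (leaf v leafHoles) := by
  obtain ⟨ha, hb, hc, hv⟩ := hj
  have hu : ∀ x, (Nat.beq x a → u x = true) ∧ (Nat.beq x b → u x = true) ∧
      (Nat.beq x c → u x = false) := fun x =>
    ⟨fun h => Nat.eq_of_beq_eq_true h ▸ ha, fun h => Nat.eq_of_beq_eq_true h ▸ hb,
      fun h => Nat.eq_of_beq_eq_true h ▸ hc⟩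
  have hkey : ∀ x ∈ keyHoles, x < 36 := by decide
  have hleaf : ∀ x ∈ leafHoles, x < 36 := by decide
  have hxor : key v keyHoles = key u keyHoles ^^^
      key (fun h => or (or (Nat.beq h a) (Nat.beq h b)) (Nat.beq h c)) keyHoles := by
    rw [key_xor]
    refine key_congr fun x hx => ?_
    rw [hv x (hkey x hx)]
    have := hu x
    revert this
    generalize Nat.beq x a = p, Nat.beq x b = q, Nat.beq x c = r, u x = y
    decide +revert
  rw [hxor]
  refine Chunks.has_jump h ?_ (testBit_pattern ?_) (leaf_mono ?_) (leaf_add_leaf ?_)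
  · rw [key_land]
    refine key_congr fun x _ => ?_
    have := hu x
    revert this
    generalize Nat.beq x a = p, Nat.beq x b = q, Nat.beq x c = r, u x = y
    decide +revert
  · intro x _
    have := hu x
    revert this
    generalize Nat.beq x a = p, Nat.beq x b = q, Nat.beq x c = r, u x = y
    decide +revert
  · intro x hx
    rw [hv x (hleaf x hx)]
    generalize Nat.beq x a = p, Nat.beq x b = q, Nat.beq x c = r, u x = y
    decide +revert
  · intro x hx
    rw [hv x (hleaf x hx)]
    have := hu x
    revert this
    generalize Nat.beq x a = p, Nat.beq x b = q, Nat.beq x c = r, u x = y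
    decide +revert

theorem Doomed.of_isJump {n a b c : ℕ} {u v : ℕ → Bool} (h : Doomed (n + 1) u)
    (hj : IsJump a b c u v) (hs : JumpTree.Sub (jump a b c) allJumps) : Doomed n v := by
  obtain ⟨_ | ⟨K, X, r⟩, h, hd⟩ := h
  · exact h.elim
  · refine ⟨_, hs (hj.has_image (Layer.has_chop 40 _ h)), ?_⟩
    have e : dies (n + 1) (.cons K X r) = Bool.rec false
      (dies n (JumpTree.image allJumps (Layer.chop 40 (.cons K X r))))
      (Layer.isNil (Layer.dropPow 11 (.cons K X r))) := rfl
    rw [e] at hd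
    cases hb : Layer.isNil (Layer.dropPow 11 (.cons K X r)) <;> rw [hb] at hd
    · cases hd
    · exact hd

theorem sub_line {s m a b c : ℕ} (hb : b = m + s)
    (h : (a = m ∧ c = m + s + s) ∨ (c = m ∧ a = m + s + s)) :
    JumpTree.Sub (jump a b c) (line s m) := by
  subst hb
  rcases h with ⟨rfl, rfl⟩ | ⟨rfl, rfl⟩
  · exact JumpTree.Sub.rfl.left _
  · exact JumpTree.Sub.rfl.right _

theorem sub_allJumps {s x y a b c : ℕ} (hb : b = 6 * x + y + s)
    (h : (a = 6 * x + y ∧ c = 6 * x + y + s + s) ∨ (c = 6 * x + y ∧ a = 6 * x + y + s + s))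
    (hs : (s = 1 ∧ x ≤ 5 ∧ y ≤ 3) ∨ (s = 6 ∧ x ≤ 3 ∧ y ≤ 5) ∨ (s = 7 ∧ x ≤ 3 ∧ y ≤ 3)) :
    JumpTree.Sub (jump a b c) allJumps := by
  have hl := sub_line hb h
  rcases hs with ⟨rfl, hx, hy⟩ | ⟨rfl, hx, hy⟩ | ⟨rfl, hx, hy⟩
  · exact .left _ (.union hx (.union hy hl))
  · exact .right _ (.left _ (.union hx (.union hy hl)))
  · exact .right _ (.right _ (.union hx (.union hy hl)))

/-- The holes that are empty before the last sweep. -/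
def startHole (h : ℕ) : Bool :=
  Nat.beq (h / 6) 0 || Nat.beq (h % 6) 5 ||
    (Nat.beq (h / 6 % 2) 1 && Nat.beq (h % 6 % 2) 0 && !Nat.beq h 6)

noncomputable def startLayer : Layer :=
  .cons (key startHole keyHoles) (Nat.shiftLeft 1 (leaf startHole leafHoles)) .nil

theorem dies_startLayer : dies 18 startLayer = true := by
  decide +kernel

theorem doomed_of_eq_startHole {u : ℕ → Bool} (hu : ∀ h < 36, u h = startHole h) :
    Doomed 18 u := by
  have hkey : ∀ x ∈ keyHoles, x < 36 := by decide
  have hleaf : ∀ x ∈ leafHoles, x < 36 := by decide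
  refine ⟨startLayer, .inl ⟨?_, ?_⟩, dies_startLayer⟩
  · exact (key_congr fun x hx => hu x (hkey x hx)).symm
  · rw [leaf_congr fun x hx => hu x (hleaf x hx)]
    change (1 <<< leaf startHole leafHoles).testBit _ = true
    simp

/-! ### The game -/

/-- The hole with number `h`. -/
def hole (h : ℕ) : ℤ × ℤ := (((h / 6 : ℕ) : ℤ), ((h % 6 : ℕ) : ℤ))

/-- The number of a hole. -/
def number (p : ℤ × ℤ) : ℕ := (6 * p.1 + p.2).toNat

/-- The indicator function of the empty holes. -/
def vacant (P : Finset (ℤ × ℤ)) (h : ℕ) : Bool := decide (hole h ∉ P)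

theorem mem_rhombus_six {p : ℤ × ℤ} :
    p ∈ Rhombus 6 ↔ (0 ≤ p.1 ∧ p.1 ≤ 5) ∧ 0 ≤ p.2 ∧ p.2 ≤ 5 := by
  simp [Rhombus]

theorem hole_number {p : ℤ × ℤ} (hp : p ∈ Rhombus 6) : hole (number p) = p := by
  rw [mem_rhombus_six] at hp
  simp only [hole, number, Prod.ext_iff]
  omega

theorem hole_eq_iff {p : ℤ × ℤ} (hp : p ∈ Rhombus 6) {h : ℕ} :
    hole h = p ↔ Nat.beq h (number p) = true := by
  rw [Nat.beq_eq]
  refine ⟨fun e => ?_, fun e => e ▸ hole_number hp⟩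
  subst e
  simp only [hole, number]
  omega

theorem ne_zero_of_mem_dirs {d : ℤ × ℤ} (hd : d ∈ Dirs) : d ≠ 0 ∧ d + d ≠ 0 := by
  revert d
  decide

section Jump

variable {B P : Finset (ℤ × ℤ)} {p d : ℤ × ℤ}

theorem card_jumpResult (h : JumpOK B P p d) : P.card = (jumpResult P p d).card + 1 := by
  obtain ⟨hd, hp, hq, -, hr⟩ := h
  have hpq : p ≠ p + d := by simpa using (ne_zero_of_mem_dirs hd).1
  have hsub : {p, p + d} ⊆ P := by simp [Finset.insert_subset_iff, hp, hq]
  have h₁ := Finset.card_sdiff_add_card_eq_card hsub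
  rw [Finset.card_pair hpq] at h₁
  rw [jumpResult, Finset.card_union_of_disjoint (by simp [hr]), Finset.card_singleton]
  omega

theorem jumpResult_subset (hP : P ⊆ B) (h : JumpOK B P p d) : jumpResult P p d ⊆ B :=
  Finset.union_subset (Finset.sdiff_subset.trans hP) (Finset.singleton_subset_iff.2 h.2.2.2.1)

theorem isJump_vacant (hP : P ⊆ Rhombus 6) (h : JumpOK (Rhombus 6) P p d) :
    IsJump (number p) (number (p + d)) (number (p + d + d)) (vacant (jumpResult P p d))
      (vacant P) := by
  obtain ⟨hd, hp, hq, hrB, hr⟩ := h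
  obtain ⟨hd₁, hd₂⟩ := ne_zero_of_mem_dirs hd
  have hpr : p ≠ p + d + d := by simpa [add_assoc] using hd₂
  have hqr : p + d ≠ p + d + d := by simpa using hd₁
  refine ⟨?_, ?_, ?_, fun h _ => ?_⟩
  · simp [vacant, hole_number (hP hp), jumpResult, add_assoc, hd₂]
  · simp [vacant, hole_number (hP hq), jumpResult, hd₁]
  · simp [vacant, hole_number hrB, jumpResult]
  · rw [Bool.eq_iff_iff]
    simp only [vacant, Bool.or_eq_true, Bool.and_eq_true, Bool.not_eq_true', ← Bool.not_eq_true,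
      decide_eq_true_eq, ← hole_eq_iff (hP hp), ← hole_eq_iff (hP hq), ← hole_eq_iff hrB]
    generalize hole h = z
    simp only [jumpResult, Finset.mem_union, Finset.mem_sdiff, Finset.mem_insert,
      Finset.mem_singleton]
    by_cases h₁ : z = p
    · subst h₁; simp [hp, hpr]
    by_cases h₂ : z = p + d
    · subst h₂; simp [hq, hqr]
    by_cases h₃ : z = p + d + d
    · subst h₃; simp [hr]
    simp [h₁, h₂, h₃]

theorem sub_allJumps_number (hp : p ∈ Rhombus 6) (hd : d ∈ Dirs) (hr : p + d + d ∈ Rhombus 6) :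
    JumpTree.Sub (jump (number p) (number (p + d)) (number (p + d + d))) allJumps := by
  obtain ⟨x, y⟩ := p
  obtain ⟨dx, dy⟩ := d
  simp only [mem_rhombus_six, Prod.mk_add_mk] at hp hr
  obtain ⟨⟨hx, hx'⟩, hy, hy'⟩ := hp
  simp only [Dirs, Finset.mem_insert, Finset.mem_singleton, Prod.mk.injEq] at hd
  simp only [number, Prod.mk_add_mk]
  refine sub_allJumps (s := (6 * dx + dy).natAbs) (x := (min x (x + dx + dx)).toNat)
    (y := (min y (y + dy + dy)).toNat) ?_ ?_ ?_ <;>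
  rcases hd with ⟨rfl, rfl⟩ | ⟨rfl, rfl⟩ | ⟨rfl, rfl⟩ | ⟨rfl, rfl⟩ | ⟨rfl, rfl⟩ | ⟨rfl, rfl⟩ <;>
  omega

end Jump

theorem SweepFrom.doomed {P Q : Finset (ℤ × ℤ)} {s e : ℤ × ℤ} {ds : List (ℤ × ℤ)}
    (h : SweepFrom (Rhombus 6) P s ds e Q) (hP : P ⊆ Rhombus 6) :
    Q ⊆ Rhombus 6 ∧ P.card = Q.card + ds.length ∧
      ∀ n, Doomed (n + ds.length) (vacant Q) → Doomed n (vacant P) := by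
  induction h with
  | nil => exact ⟨hP, rfl, fun n h => h⟩
  | @cons P s d e ds Q hj _ ih =>
    obtain ⟨hQ, hcard, hdoomed⟩ := ih (jumpResult_subset hP hj)
    have hc := card_jumpResult hj
    refine ⟨hQ, by rw [List.length_cons]; omega, fun n h => ?_⟩
    refine Doomed.of_isJump (hdoomed (n + 1) ?_) (isJump_vacant hP hj)
      (sub_allJumps_number (hP hj.2.1) hj.1 hj.2.2.2.1)
    rwa [List.length_cons, Nat.add_comm ds.length, ← Nat.add_assoc] at h

theorem Plays.doomed {P Q : Finset (ℤ × ℤ)} {ms : List ((ℤ × ℤ) × List (ℤ × ℤ))}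
    (h : Plays (Rhombus 6) P ms Q) (hP : P ⊆ Rhombus 6) :
    Q ⊆ Rhombus 6 ∧ ∃ N, P.card = Q.card + N ∧
      ∀ n, Doomed (n + N) (vacant Q) → Doomed n (vacant P) := by
  induction h with
  | nil => exact ⟨hP, 0, rfl, fun n h => h⟩
  | cons hm _ ih =>
    obtain ⟨-, e, hs⟩ := hm
    obtain ⟨hQ, hcard, hdoomed⟩ := SweepFrom.doomed hs hP
    obtain ⟨hR, N, hcard', hdoomed'⟩ := ih hQ
    refine ⟨hR, N + _, by rw [hcard, hcard', Nat.add_assoc], fun n h => hdoomed n (hdoomed' _ ?_)⟩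
    rwa [Nat.add_assoc, Nat.add_comm _ N]

theorem Plays.exists_last {B P R : Finset (ℤ × ℤ)} {ms : List ((ℤ × ℤ) × List (ℤ × ℤ))}
    {m : (ℤ × ℤ) × List (ℤ × ℤ)} (h : Plays B P (ms ++ [m]) R) :
    ∃ Q, Plays B P ms Q ∧ PlayMove B Q m R := by
  induction ms generalizing P with
  | nil =>
    cases h with
    | cons hm h =>
      cases h
      exact ⟨P, .nil P, hm⟩
  | cons m' ms ih =>
    cases h with
    | cons hm h =>
      obtain ⟨Q, hQ, hR⟩ := ih h
      exact ⟨Q, .cons hm hQ, hR⟩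

/-! ### The position before the last sweep -/

/-- The holes over which a peg starting from `(1, 0)` can jump. -/
noncomputable def middles : Finset (ℤ × ℤ) :=
  (Finset.Icc (1 : ℤ) 5 ×ˢ Finset.Icc (0 : ℤ) 4).filter fun p => ¬ (p.1 % 2 = 1 ∧ p.2 % 2 = 0)

theorem card_inter_middles {P : Finset (ℤ × ℤ)} {p d : ℤ × ℤ} (hP : P ⊆ Rhombus 6)
    (h : JumpOK (Rhombus 6) P p d) (hp : p.1 % 2 = 1 ∧ p.2 % 2 = 0) :
    (P ∩ middles).card = (jumpResult P p d ∩ middles).card + 1 := by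
  obtain ⟨hd, hpP, hq, hrB, hr⟩ := h
  have hpB := mem_rhombus_six.1 (hP hpP)
  rw [mem_rhombus_six] at hrB
  obtain ⟨x, y⟩ := p
  obtain ⟨dx, dy⟩ := d
  simp only [Prod.mk_add_mk] at *
  simp only [Dirs, Finset.mem_insert, Finset.mem_singleton, Prod.mk.injEq] at hd
  have hqm : (x + dx, y + dy) ∈ middles := by
    simp only [middles, Finset.mem_filter, Finset.mem_product, Finset.mem_Icc]
    omega
  have hpm : (x, y) ∉ middles := by
    simp only [middles, Finset.mem_filter, Finset.mem_product, Finset.mem_Icc]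
    omega
  have hrm : (x + dx + dx, y + dy + dy) ∉ middles := by
    simp only [middles, Finset.mem_filter, Finset.mem_product, Finset.mem_Icc]
    omega
  have he : jumpResult P (x, y) (dx, dy) ∩ middles =
      (P ∩ middles).erase (x + dx, y + dy) := by
    ext z
    simp only [jumpResult, Prod.mk_add_mk, Finset.mem_inter, Finset.mem_union, Finset.mem_sdiff,
      Finset.mem_insert, Finset.mem_singleton, Finset.mem_erase]
    constructor
    · rintro ⟨⟨hz, hne⟩ | rfl, hm⟩
      · exact ⟨fun h => hne (.inr h), hz, hm⟩
      · exact absurd hm hrm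
    · rintro ⟨hne, hz, hm⟩
      refine ⟨.inl ⟨hz, ?_⟩, hm⟩
      rintro (rfl | h)
      · exact hpm hm
      · exact hne h
  rw [he, Finset.card_erase_add_one (Finset.mem_inter.2 ⟨hq, hqm⟩)]

theorem SweepFrom.card_inter_middles {P Q : Finset (ℤ × ℤ)} {s e : ℤ × ℤ} {ds : List (ℤ × ℤ)}
    (h : SweepFrom (Rhombus 6) P s ds e Q) (hP : P ⊆ Rhombus 6)
    (hs : s.1 % 2 = 1 ∧ s.2 % 2 = 0) :
    (P ∩ middles).card = (Q ∩ middles).card + ds.length := by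
  induction h with
  | nil => rfl
  | @cons P s d e ds Q hj _ ih =>
    have h₁ := RhombusSearch.card_inter_middles hP hj hs
    have h₂ := ih (jumpResult_subset hP hj) (by simp only [Prod.fst_add, Prod.snd_add]; omega)
    rw [List.length_cons]
    omega

/-- A sweep of length 16 from `(1, 0)` that leaves one peg determines the position. -/
theorem SweepFrom.eq_insert_middles {P Q : Finset (ℤ × ℤ)} {e : ℤ × ℤ} {ds : List (ℤ × ℤ)}
    (h : SweepFrom (Rhombus 6) P (1, 0) ds e Q) (hP : P ⊆ Rhombus 6) (hds : ds.length = 16)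
    (hQ : Q.card = 1) : P = insert (1, 0) middles := by
  have hm := SweepFrom.card_inter_middles h hP (by decide)
  have hmid : middles.card = 16 := by decide
  have hsub : middles ⊆ P := by
    refine Finset.inter_eq_right.1 (Finset.eq_of_subset_of_card_le Finset.inter_subset_right ?_)
    omega
  have hpos : ((1, 0) : ℤ × ℤ) ∈ P := by
    cases h with
    | nil => simp at hds
    | cons hj _ => exact hj.2.1
  refine (Finset.eq_of_subset_of_card_le (Finset.insert_subset hpos hsub) ?_).symm
  rw [(SweepFrom.doomed h hP).2.1, Finset.card_insert_of_notMem (by decide)]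
  omega

theorem vacant_insert_middles :
    ∀ h < 36, vacant (insert (1, 0) middles) h = startHole h := by
  decide

end RhombusSearch

/-- On `Rhombus 6`, no single-vacancy problem has a solution whose last
move is a sweep of length 16 beginning at b1 = (1,0) and ending at f5 = (5,4). -/
theorem rhombus6_no_final_16sweep_b1_f5 :
    ¬ ∃ v ∈ Rhombus 6,
        ∃ (ms : List ((ℤ × ℤ) × List (ℤ × ℤ))) (m : (ℤ × ℤ) × List (ℤ × ℤ))
          (R : Finset (ℤ × ℤ)),
          Plays (Rhombus 6) ((Rhombus 6).erase v) (ms ++ [m]) R ∧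
          R.card = 1 ∧
          m.2.length = 16 ∧
          m.1 = ((1 : ℤ), (0 : ℤ)) ∧
          sweepEnd m.1 m.2 = ((5 : ℤ), (4 : ℤ)) := by
  rintro ⟨v, hv, ms, m, R, hplay, hR, hlen, hstart, -⟩
  obtain ⟨Q, hQ, -, e, hsweep⟩ := RhombusSearch.Plays.exists_last hplay
  obtain ⟨hQB, N, hcard, hdoomed⟩ := RhombusSearch.Plays.doomed hQ (Finset.erase_subset _ _)
  rw [hstart] at hsweep
  have hlast := (RhombusSearch.SweepFrom.doomed hsweep hQB).2.1
  have hB : (Rhombus 6).card = 36 := by simp [Rhombus]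
  rw [Finset.card_erase_of_mem hv, hB] at hcard
  obtain rfl : N = 18 := by omega
  rw [RhombusSearch.SweepFrom.eq_insert_middles hsweep hQB hlen hR] at hdoomed
  exact RhombusSearch.not_doomed_zero _
    (hdoomed 0 (RhombusSearch.doomed_of_eq_startHole RhombusSearch.vacant_insert_middles))
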